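/- Let K be an algebraically closed field and let A and B be finite-dimensional simple (not necessarily associative or unital) K-algebras. If A and B satisfy the same polynomial identities, then A and B are isomorphic as K-algebras. -/

import Mathlib

/-!
STATEMENT 2: Let K be an algebraically closed field and let A and B be finite-dimensional
simple (not necessarily associative or unital) K-algebras. If A and B satisfy the same
polynomial identities, then A and B are isomorphic as K-algebras.
-/

/-- `I` is a two-sided ideal of the (not necessarily associative or unital) `K`-algebra `A`. -/
def IsIdeal {K A : Type*} [Field K] [NonUnitalNonAssocRing A] [Module K A]
    (I : Submodule K A) : Prop :=
  ∀ a ∈ I, ∀ b : A, a * b ∈ I ∧ b * a ∈ I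

/-- `A` is a simple algebra: `A·A ≠ 0` and the only two-sided ideals are `0` and `A`. -/
def IsSimpleAlg (K A : Type*) [Field K] [NonUnitalNonAssocRing A] [Module K A] : Prop :=
  (∃ a b : A, a * b ≠ 0) ∧ ∀ I : Submodule K A, IsIdeal I → I = ⊥ ∨ I = ⊤

/-- `f`, an element of the free nonassociative algebra `K⟨X⟩` on a countably infinite set
of variables `X = ℕ` (the `K`-vector space with basis the free magma on `ℕ`), is a
polynomial identity of `A`: every evaluation `v : X → A` kills `f`. -/
def IsPI {K A : Type*} [Field K] [NonUnitalNonAssocRing A] [Module K A]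
    [SMulCommClass K A A] [IsScalarTower K A A]
    (f : FreeNonUnitalNonAssocAlgebra K ℕ) : Prop :=
  ∀ v : ℕ → A, FreeNonUnitalNonAssocAlgebra.lift K v f = 0

/-- Left multiplication by `a`, as an additive endomorphism. -/
def opLeft {F : Type*} [NonUnitalNonAssocRing F] (a : F) : AddMonoid.End F :=
  AddMonoidHom.mulLeft a

/-- Right multiplication by `a`, as an additive endomorphism. -/
def opRight {F : Type*} [NonUnitalNonAssocRing F] (a : F) : AddMonoid.End F :=
  AddMonoidHom.mulRight a

/-- The ring of additive endomorphisms of `F` generated by all left and right multiplications. -/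
def multRing (F : Type*) [NonUnitalNonAssocRing F] : Subring (AddMonoid.End F) :=
  Subring.closure (Set.range opLeft ∪
    Set.range opRight)

/-- The linear map `T` is the action on `V` of the operator `E` on `F`, along `φ : F → V`. -/
def Intertwines {F V Q : Type*} [NonUnitalNonAssocRing F] [NonUnitalNonAssocRing V] [Field Q]
    [Module Q V] (φ : F →ₙ+* V) (E : AddMonoid.End F) (T : Module.End Q V) : Prop :=
  ∀ x, φ (E x) = T (φ x)

/-- `φ : F → V` has dense image: its range spans `V` over `Q`, the multiplication operators of `F`
span all linear endomorphisms of `V`, and the product of `V` is not zero. -/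
structure IsDenseHom (Q : Type*) {F V : Type*} [NonUnitalNonAssocRing F]
    [NonUnitalNonAssocRing V] [Field Q] [Module Q V] (φ : F →ₙ+* V) : Prop where
  span_range : Submodule.span Q (Set.range φ) = ⊤
  span_ops : Submodule.span Q {T : Module.End Q V | ∃ E ∈ multRing F, Intertwines φ E T} = ⊤
  exists_mul_ne_zero : ∃ a b : V, a * b ≠ 0

section Dense

variable {F V Q : Type*} [NonUnitalNonAssocRing F] [NonUnitalNonAssocRing V] [Field Q]
  [Module Q V] {φ : F →ₙ+* V}

theorem mulLeft_mem_multRing (a : F) : opLeft a ∈ multRing F :=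
  Subring.subset_closure (Or.inl ⟨a, rfl⟩)

theorem mulRight_mem_multRing (a : F) : opRight a ∈ multRing F :=
  Subring.subset_closure (Or.inr ⟨a, rfl⟩)

namespace Intertwines

theorem one : Intertwines φ 1 (1 : Module.End Q V) := fun _ => rfl

theorem mul {E E' : AddMonoid.End F} {T T' : Module.End Q V} (h : Intertwines φ E T)
    (h' : Intertwines φ E' T') : Intertwines φ (E * E') (T * T') := fun x => by
  change φ (E (E' x)) = T (T' (φ x))
  rw [h, h']

theorem add {E E' : AddMonoid.End F} {T T' : Module.End Q V} (h : Intertwines φ E T)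
    (h' : Intertwines φ E' T') : Intertwines φ (E + E') (T + T') := fun x => by
  rw [LinearMap.add_apply, ← h x, ← h' x, ← map_add]; rfl

theorem sub {E E' : AddMonoid.End F} {T T' : Module.End Q V} (h : Intertwines φ E T)
    (h' : Intertwines φ E' T') : Intertwines φ (E - E') (T - T') := fun x => by
  rw [LinearMap.sub_apply, ← h x, ← h' x, ← map_sub]; rfl

variable [SMulCommClass Q V V] [IsScalarTower Q V V]

omit [IsScalarTower Q V V] in
theorem mulLeft (a : F) :
    Intertwines φ (opLeft a) (LinearMap.mulLeft Q (φ a)) := fun x =>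
  map_mul φ a x

omit [SMulCommClass Q V V] in
theorem mulRight (a : F) :
    Intertwines φ (opRight a) (LinearMap.mulRight Q (φ a)) := fun x =>
  map_mul φ x a

theorem exists_of_mem {E : AddMonoid.End F} (hE : E ∈ multRing F) :
    ∃ T : Module.End Q V, Intertwines φ E T := by
  induction hE using Subring.closure_induction with
  | mem E h =>
    rcases h with ⟨a, rfl⟩ | ⟨a, rfl⟩
    · exact ⟨_, mulLeft a⟩
    · exact ⟨_, mulRight a⟩
  | zero => exact ⟨0, fun x => by simp⟩
  | one => exact ⟨1, one⟩
  | add _ _ _ _ h h' =>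
    obtain ⟨⟨T, hT⟩, ⟨T', hT'⟩⟩ := And.intro h h'
    exact ⟨_, hT.add hT'⟩
  | neg _ _ h =>
    obtain ⟨T, hT⟩ := h
    exact ⟨-T, fun x => by rw [LinearMap.neg_apply, ← hT x, ← map_neg]; rfl⟩
  | mul _ _ _ _ h h' =>
    obtain ⟨⟨T, hT⟩, ⟨T', hT'⟩⟩ := And.intro h h'
    exact ⟨_, hT.mul hT'⟩

end Intertwines

namespace IsDenseHom

variable [SMulCommClass Q V V] [IsScalarTower Q V V]

/-- An identity bilinear in two multiplication operators extends to all pairs of linear maps. -/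
theorem mul_eq_mul (hφ : IsDenseHom Q φ) {p q r s : V}
    (h : ∀ E ∈ multRing F, ∀ E' ∈ multRing F, ∀ T T' : Module.End Q V,
      Intertwines φ E T → Intertwines φ E' T' → T p * T' q = T r * T' s)
    (T T' : Module.End Q V) : T p * T' q = T r * T' s := by
  have hT : T ∈ Submodule.span Q {T | ∃ E ∈ multRing F, Intertwines φ E T} := by
    rw [hφ.span_ops]; trivial
  have hT' : T' ∈ Submodule.span Q {T | ∃ E ∈ multRing F, Intertwines φ E T} := by
    rw [hφ.span_ops]; trivial
  induction hT using Submodule.span_induction with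
  | zero => simp
  | add _ _ _ _ h h' => simp [add_mul, h, h']
  | smul c _ _ h => simp [smul_mul_assoc, h]
  | mem T hT =>
    obtain ⟨E, hE, hET⟩ := hT
    induction hT' using Submodule.span_induction with
    | zero => simp
    | add _ _ _ _ h h' => simp [mul_add, h, h']
    | smul c _ _ h => simp [mul_smul_comm, h]
    | mem T' hT' =>
      obtain ⟨E', hE', hET'⟩ := hT'
      exact h E hE E' hE' T T' hET hET'

theorem mem_span_singleton (hφ : IsDenseHom Q φ) {p q r s : V} (hq : q ≠ 0)
    (h : ∀ E ∈ multRing F, ∀ E' ∈ multRing F, ∀ T T' : Module.End Q V,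
      Intertwines φ E T → Intertwines φ E' T' → T p * T' q = T r * T' s) :
    p ∈ Submodule.span Q {r} := by
  obtain ⟨a, b, hab⟩ := hφ.exists_mul_ne_zero
  by_contra hp
  obtain ⟨f, hfp, hf⟩ := Submodule.exists_le_ker_of_notMem hp
  obtain ⟨g, hg⟩ : ∃ g : V →ₗ[Q] Q, g q ≠ 0 := by
    by_contra! hg
    exact hq ((Module.forall_dual_apply_eq_zero_iff Q q).1 hg)
  have hr : f r = 0 := hf (Submodule.mem_span_singleton_self r)
  have := hφ.mul_eq_mul h (f.smulRight a) (g.smulRight b)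
  simp [smul_mul_assoc, mul_smul_comm, hr, hg, hfp, hab] at this

/-- Some multiplication operators move two nonzero elements to elements with nonzero product. -/
theorem exists_op_mul_ne_zero (hφ : IsDenseHom Q φ) {p q : V} (hp : p ≠ 0) (hq : q ≠ 0) :
    ∃ E ∈ multRing F, ∃ E' ∈ multRing F, ∃ T T' : Module.End Q V,
      Intertwines φ E T ∧ Intertwines φ E' T' ∧ T p * T' q ≠ 0 := by
  by_contra! h
  have := hφ.mem_span_singleton (p := p) (r := 0) (s := 0) hq fun E hE E' hE' T T' hT hT' => by
    rw [h E hE E' hE' T T' hT hT', map_zero, zero_mul]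
  simp [hp] at this

/-- A vector killed by every multiplication operator that kills `φ '' U` is in the span of
`φ '' U`. -/
theorem mem_span_of_forall (hφ : IsDenseHom Q φ) (U : Set F) (hU : U.Finite) :
    ∀ w : V, (∀ E ∈ multRing F, ∀ T : Module.End Q V, Intertwines φ E T →
      (∀ u ∈ U, φ (E u) = 0) → T w = 0) → w ∈ Submodule.span Q (φ '' U) := by
  induction U, hU using Set.Finite.induction_on with
  | empty => intro w hw; simpa using hw 1 (one_mem _) 1 Intertwines.one (by simp)
  | @insert u U _ _ ih =>
    intro w hw
    rw [Set.image_insert_eq]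
    by_cases hu : φ u ∈ Submodule.span Q (φ '' U)
    · refine Submodule.span_mono (Set.subset_insert _ _) (ih w fun E hE T hT hEU =>
        hw E hE T hT ?_)
      rintro v (rfl | hv)
      · rw [hT]
        have hle : Submodule.span Q (φ '' U) ≤ LinearMap.ker T := by
          rw [Submodule.span_le]
          rintro _ ⟨y, hy, rfl⟩
          rw [SetLike.mem_coe, LinearMap.mem_ker, ← hT, hEU y hy]
        exact hle hu
      · exact hEU v hv
    · have key : ∀ E ∈ multRing F, ∀ T : Module.End Q V, Intertwines φ E T →
          (∀ u ∈ U, φ (E u) = 0) → ∀ E' ∈ multRing F, ∀ T' : Module.End Q V,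
          Intertwines φ E' T' → (∀ u ∈ U, φ (E' u) = 0) →
          ∀ S ∈ multRing F, ∀ S' ∈ multRing F, ∀ R R' : Module.End Q V,
          Intertwines φ S R → Intertwines φ S' R' →
          R (T w) * R' (T' (φ u)) = R (T (φ u)) * R' (T' w) := by
        intro E hE T hT hEU E' hE' T' hT' hEU' S hS S' hS' R R' hR hR'
        have := hw (opRight (S' (E' u)) * (S * E) -
            opLeft (S (E u)) * (S' * E'))
          (sub_mem (mul_mem (mulRight_mem_multRing _) (mul_mem hS hE))
            (mul_mem (mulLeft_mem_multRing _) (mul_mem hS' hE'))) _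
          (((Intertwines.mulRight _).mul (hR.mul hT)).sub
            ((Intertwines.mulLeft _).mul (hR'.mul hT'))) ?_
        · simpa [sub_eq_zero, hR _, hT _, hR' _, hT' _] using this
        · rintro v hv
          change φ (S (E v) * S' (E' u) - S (E u) * S' (E' v)) = 0
          rcases hv with rfl | hv
          · simp
          · simp [hR _, hR' _, hEU v hv, hEU' v hv]
      obtain ⟨E₀, hE₀, T₀, hT₀, hEU₀, hne⟩ : ∃ E ∈ multRing F, ∃ T : Module.End Q V,
          Intertwines φ E T ∧ (∀ u ∈ U, φ (E u) = 0) ∧ T (φ u) ≠ 0 := by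
        by_contra! h
        exact hu (ih _ h)
      obtain ⟨c, hc⟩ := Submodule.mem_span_singleton.1 (hφ.mem_span_singleton hne
        (key E₀ hE₀ T₀ hT₀ hEU₀ E₀ hE₀ T₀ hT₀ hEU₀))
      have := ih (w - c • φ u) fun E hE T hT hEU => by
        rw [map_sub, map_smul]
        by_contra hn
        obtain ⟨S, hS, S', hS', R, R', hR, hR', hRR⟩ := hφ.exists_op_mul_ne_zero hn hne
        apply hRR
        have := key E hE T hT hEU E₀ hE₀ T₀ hT₀ hEU₀ S hS S' hS' R R' hR hR'
        rw [map_sub, sub_mul, this, ← hc]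
        simp [smul_mul_assoc, mul_smul_comm]
      rw [Submodule.mem_span_insert]
      exact ⟨c, w - c • φ u, this, by abel⟩

/-- Elements of `F` with linearly independent images are separated by multiplication operators. -/
theorem exists_separating (hφ : IsDenseHom Q φ) {ι : Type*} [Finite ι] {u : ι → F}
    (hu : LinearIndependent Q (fun i => φ (u i))) (k : ι) :
    ∃ E ∈ multRing F, φ (E (u k)) ≠ 0 ∧ ∀ l ≠ k, φ (E (u l)) = 0 := by
  by_contra! h
  have hk := linearIndependent_iff_notMem_span.1 hu k
  apply hk
  have := hφ.mem_span_of_forall (u '' {k}ᶜ) (Set.toFinite _) (φ (u k)) fun E hE T hT hEU => by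
    rw [← hT]
    by_contra hne
    obtain ⟨l, hl, hl'⟩ := h E hE hne
    exact hl' (hEU _ ⟨l, hl, rfl⟩)
  rwa [Set.image_image, Set.compl_eq_univ_sdiff] at this

end IsDenseHom

end Dense
open scoped TensorProduct

universe u v

section Pair

variable {K F V Q V' Q' : Type*} [Field K] [NonUnitalNonAssocRing F] [Module K F]
  [NonUnitalNonAssocRing V] [Field Q] [Algebra K Q] [Module Q V]
  [SMulCommClass Q V V] [IsScalarTower Q V V]
  [NonUnitalNonAssocRing V'] [Field Q'] [Algebra K Q'] [Module Q' V']
  [SMulCommClass Q' V' V'] [IsScalarTower Q' V' V']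
  {φ : F →ₙ+* V} {ψ : F →ₙ+* V'}

omit [SMulCommClass Q V V] [IsScalarTower Q V V] in
theorem IsDenseHom.exists_apply_ne_zero (hφ : IsDenseHom Q φ) : ∃ f, φ f ≠ 0 := by
  by_contra! h
  obtain ⟨a, b, hab⟩ := hφ.exists_mul_ne_zero
  have ha : a ∈ Submodule.span Q (Set.range φ) := by rw [hφ.span_range]; trivial
  have h0 : Submodule.span Q (Set.range φ) ≤ ⊥ := by
    rw [Submodule.span_le]
    rintro _ ⟨x, rfl⟩
    simpa using h x
  rw [(Submodule.mem_bot Q).1 (h0 ha), zero_mul] at hab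
  exact hab rfl

/-- The pairs of scalars by which a nonzero element of `F` can be multiplied simultaneously in
both images of `F`. -/
def commonScalars (hφ : IsDenseHom Q φ)
    (hφK : ∀ (k : K) f, φ (k • f) = algebraMap K Q k • φ f)
    (hψK : ∀ (k : K) f, ψ (k • f) = algebraMap K Q' k • ψ f) : Subalgebra K (Q × Q') where
  carrier := {c | ∃ f g, φ f ≠ 0 ∧ φ g = c.1 • φ f ∧ ψ g = c.2 • ψ f}
  algebraMap_mem' k := by
    obtain ⟨f, hf⟩ := hφ.exists_apply_ne_zero
    exact ⟨f, k • f, hf, hφK k f, hψK k f⟩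
  mul_mem' := by
    rintro ⟨c, c'⟩ ⟨d, d'⟩ ⟨f, g, hf, hg, hg'⟩ ⟨f₁, g₁, hf₁, hg₁, hg₁'⟩
    obtain ⟨E, hE, E', hE', T, T', hT, hT', hne⟩ := hφ.exists_op_mul_ne_zero hf hf₁
    rw [← hT, ← hT', ← map_mul] at hne
    obtain ⟨S, hS⟩ := Intertwines.exists_of_mem (Q := Q') (φ := ψ) hE
    obtain ⟨S', hS'⟩ := Intertwines.exists_of_mem (Q := Q') (φ := ψ) hE'
    refine ⟨E f * E' f₁, E g * E' g₁, hne, ?_, ?_⟩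
    · simp only [map_mul, hT _, hT' _, hg, hg₁, map_smul, smul_mul_assoc, mul_smul_comm, smul_smul,
        mul_comm d, Prod.fst_mul]
    · simp only [map_mul, hS _, hS' _, hg', hg₁', map_smul, smul_mul_assoc, mul_smul_comm,
        smul_smul, mul_comm d', Prod.snd_mul]
  add_mem' := by
    rintro ⟨c, c'⟩ ⟨d, d'⟩ ⟨f, g, hf, hg, hg'⟩ ⟨f₁, g₁, hf₁, hg₁, hg₁'⟩
    obtain ⟨E, hE, E', hE', T, T', hT, hT', hne⟩ := hφ.exists_op_mul_ne_zero hf hf₁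
    rw [← hT, ← hT', ← map_mul] at hne
    obtain ⟨S, hS⟩ := Intertwines.exists_of_mem (Q := Q') (φ := ψ) hE
    obtain ⟨S', hS'⟩ := Intertwines.exists_of_mem (Q := Q') (φ := ψ) hE'
    refine ⟨E f * E' f₁, E g * E' f₁ + E f * E' g₁, hne, ?_, ?_⟩
    · simp only [map_add, map_mul, hT _, hT' _, hg, hg₁, map_smul, smul_mul_assoc, mul_smul_comm,
        Prod.fst_add, add_smul]
    · simp only [map_add, map_mul, hS _, hS' _, hg', hg₁', map_smul, smul_mul_assoc,
        mul_smul_comm, Prod.snd_add, add_smul]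

theorem fst_eq_zero_iff_of_mem_commonScalars (hφ : IsDenseHom Q φ)
    (hker : ∀ f, φ f = 0 ↔ ψ f = 0)
    (hφK : ∀ (k : K) f, φ (k • f) = algebraMap K Q k • φ f)
    (hψK : ∀ (k : K) f, ψ (k • f) = algebraMap K Q' k • ψ f) {c : Q × Q'}
    (hc : c ∈ commonScalars hφ hφK hψK) : c.1 = 0 ↔ c.2 = 0 := by
  obtain ⟨f, g, hf, hg, hg'⟩ := hc
  have hf' : ψ f ≠ 0 := fun h => hf ((hker f).2 h)
  rw [← smul_eq_zero_iff_left hf, ← smul_eq_zero_iff_left hf', ← hg, ← hg', hker]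

omit [SMulCommClass Q' V' V'] [IsScalarTower Q' V' V'] [SMulCommClass Q V V]
  [IsScalarTower Q V V] in
theorem smul_apply_of_separating {ι : Type*} [Fintype ι] {E : AddMonoid.End F}
    {T : Module.End Q V} (hT : Intertwines φ E T) {u : ι → F} {k : ι}
    (hE : ∀ l ≠ k, φ (E (u l)) = 0) (c : ι → Q) :
    T (∑ i, c i • φ (u i)) = c k • φ (E (u k)) := by
  rw [map_sum, Finset.sum_eq_single k, map_smul, hT]
  · intro l _ hl
    rw [map_smul, ← hT, hE l hl, smul_zero]
  · simp

theorem IsDenseHom.linearIndependent_transfer (hφ : IsDenseHom Q φ)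
    (hker : ∀ f, φ f = 0 ↔ ψ f = 0) {ι : Type*} [Fintype ι] {u : ι → F}
    (hu : LinearIndependent Q (fun i => φ (u i))) :
    LinearIndependent Q' (fun i => ψ (u i)) := by
  rw [Fintype.linearIndependent_iff]
  intro c hc k
  obtain ⟨E, hE, hne, hl⟩ := hφ.exists_separating hu k
  obtain ⟨T, hT⟩ := Intertwines.exists_of_mem (Q := Q') (φ := ψ) hE
  have := smul_apply_of_separating hT (fun l h => (hker _).1 (hl l h)) c
  rw [hc, map_zero, eq_comm, smul_eq_zero, ← hker] at this
  exact this.resolve_right hne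

theorem repr_mem_commonScalars (hφ : IsDenseHom Q φ)
    (hker : ∀ f, φ f = 0 ↔ ψ f = 0)
    (hφK : ∀ (k : K) f, φ (k • f) = algebraMap K Q k • φ f)
    (hψK : ∀ (k : K) f, ψ (k • f) = algebraMap K Q' k • ψ f) {ι : Type*} [Fintype ι]
    {u : ι → F} (β : Module.Basis ι Q V) (hβ : ∀ i, β i = φ (u i))
    (β' : Module.Basis ι Q' V') (hβ' : ∀ i, β' i = ψ (u i)) (x : F) (k : ι) :
    (β.repr (φ x) k, β'.repr (ψ x) k) ∈ commonScalars hφ hφK hψK := by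
  have hu : LinearIndependent Q (fun i => φ (u i)) := by
    simpa only [← hβ] using β.linearIndependent
  obtain ⟨E, hE, hne, hl⟩ := hφ.exists_separating hu k
  obtain ⟨T, hT⟩ := Intertwines.exists_of_mem (Q := Q) (φ := φ) hE
  obtain ⟨T', hT'⟩ := Intertwines.exists_of_mem (Q := Q') (φ := ψ) hE
  refine ⟨E (u k), E x, hne, ?_, ?_⟩
  · conv_lhs => rw [hT, ← β.sum_repr (φ x)]
    simp only [hβ]
    exact smul_apply_of_separating hT hl _
  · conv_lhs => rw [hT', ← β'.sum_repr (ψ x)]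
    simp only [hβ']
    exact smul_apply_of_separating hT' (fun l h => (hker _).1 (hl l h)) _

end Pair

/-- Two field extensions of `K` sharing the subalgebra `C` of scalars map to a common nonzero
`K`-algebra, compatibly on `C`. -/
theorem exists_common_extension {K : Type*} {Q : Type u} {Q' : Type v} [Field K] [Field Q]
    [Field Q'] [Algebra K Q] [Algebra K Q'] (C : Subalgebra K (Q × Q'))
    (hC : ∀ c ∈ C, c.1 = 0 ↔ c.2 = 0) :
    ∃ (Ω : Type (max u v)) (_ : CommRing Ω) (_ : Algebra K Ω) (_ : Nontrivial Ω)
      (i : Q →ₐ[K] Ω) (i' : Q' →ₐ[K] Ω), ∀ c ∈ C, i c.1 = i' c.2 := by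
  let p : C →ₐ[K] Q := (AlgHom.fst K Q Q').comp C.val
  let p' : C →ₐ[K] Q' := (AlgHom.snd K Q Q').comp C.val
  let _ : Algebra C Q := p.toRingHom.toAlgebra
  let _ : Algebra C Q' := p'.toRingHom.toAlgebra
  have : IsScalarTower K C Q := .of_algebraMap_eq fun k => rfl
  have : IsScalarTower K C Q' := .of_algebraMap_eq fun k => rfl
  have hp : Function.Injective (algebraMap C Q) := by
    rw [injective_iff_map_eq_zero]
    rintro ⟨⟨c, c'⟩, hc⟩ (h : c = 0)
    have h' : c' = 0 := (hC _ hc).1 h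
    exact Subtype.ext (Prod.ext h h')
  have hp' : Function.Injective (algebraMap C Q') := by
    rw [injective_iff_map_eq_zero]
    rintro ⟨⟨c, c'⟩, hc⟩ (h' : c' = 0)
    have h : c = 0 := (hC _ hc).2 h'
    exact Subtype.ext (Prod.ext h h')
  have := Algebra.TensorProduct.nontrivial_of_algebraMap_injective_of_isDomain C Q Q' hp hp'
  refine ⟨Q ⊗[C] Q', inferInstance, inferInstance, this,
    (Algebra.TensorProduct.includeLeft : Q →ₐ[C] Q ⊗[C] Q').restrictScalars K,
    (Algebra.TensorProduct.includeRight : Q' →ₐ[C] Q ⊗[C] Q').restrictScalars K,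
    fun c hc => ?_⟩
  exact ((Algebra.TensorProduct.includeLeft : Q →ₐ[C] Q ⊗[C] Q').commutes ⟨c, hc⟩).trans
    ((Algebra.TensorProduct.includeRight : Q' →ₐ[C] Q ⊗[C] Q').commutes ⟨c, hc⟩).symm

section Simple

variable {K A : Type*} [Field K] [NonUnitalNonAssocRing A] [Module K A] [SMulCommClass K A A]
  [IsScalarTower K A A]

/-- The associative algebra of linear maps generated by the left and right multiplications. -/
def multAlg (K A : Type*) [Field K] [NonUnitalNonAssocRing A] [Module K A] [SMulCommClass K A A]
    [IsScalarTower K A A] : Subalgebra K (Module.End K A) :=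
  Algebra.adjoin K (Set.range (LinearMap.mulLeft K) ∪ Set.range (LinearMap.mulRight K))

theorem IsSimpleAlg.isSimpleModule (hA : IsSimpleAlg K A) : IsSimpleModule (multAlg K A) A := by
  have hnt : Nontrivial A := by
    obtain ⟨a, b, hab⟩ := hA.1
    exact ⟨_, _, hab⟩
  rw [isSimpleModule_iff]
  refine { exists_pair_ne := ⟨⊥, ⊤, bot_ne_top⟩, eq_bot_or_eq_top := fun N => ?_ }
  have hN : IsIdeal (N.restrictScalars K) := fun a ha b =>
    ⟨N.smul_mem (⟨LinearMap.mulRight K b, Algebra.subset_adjoin (Or.inr ⟨b, rfl⟩)⟩ : multAlg K A)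
      ha, N.smul_mem (⟨LinearMap.mulLeft K b, Algebra.subset_adjoin (Or.inl ⟨b, rfl⟩)⟩ :
      multAlg K A) ha⟩
  refine (hA.2 _ hN).imp (fun h => ?_) (fun h => ?_)
  · simpa using h
  · simpa using h

/-- Burnside's theorem for the multiplication algebra of a simple algebra. -/
theorem IsSimpleAlg.multAlg_eq_top [IsAlgClosed K] [FiniteDimensional K A]
    (hA : IsSimpleAlg K A) : multAlg K A = ⊤ := by
  have := hA.isSimpleModule
  rw [eq_top_iff]
  rintro T -
  have hsurj := (IsSimpleModule.algebraMap_end_bijective_of_isAlgClosed (A := multAlg K A)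
    (V := A) K).2
  let f : Module.End (Module.End (multAlg K A) A) A :=
    { toFun := T
      map_add' := T.map_add
      map_smul' := fun g x => by
        obtain ⟨c, rfl⟩ := hsurj g
        exact T.map_smul c x }
  obtain ⟨s, hs⟩ := Module.Finite.fg_top (R := K) (M := A)
  obtain ⟨r, hr⟩ := jacobson_density f s
  have : T = r := LinearMap.ext_on hs fun x hx => hr x hx
  rw [this]
  exact r.2

variable {Q F : Type*} [Field Q] [Algebra K Q] [NonUnitalNonAssocRing F]

theorem span_ops_eq_top [IsAlgClosed K] [FiniteDimensional K A] (hA : IsSimpleAlg K A)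
    (φ : F →ₙ+* Q ⊗[K] A) (hφ : Submodule.span Q (Set.range φ) = ⊤) :
    Submodule.span Q {T : Module.End Q (Q ⊗[K] A) | ∃ E ∈ multRing F, Intertwines φ E T} = ⊤ := by
  set D := Submodule.span Q
    {T : Module.End Q (Q ⊗[K] A) | ∃ E ∈ multRing F, Intertwines φ E T} with hD
  have hmul : ∀ T ∈ D, ∀ T' ∈ D, T * T' ∈ D := by
    intro T hT T' hT'
    have := Submodule.mul_mem_mul hT hT'
    rw [hD, Submodule.span_mul_span] at this
    refine Submodule.span_mono ?_ this
    rintro _ ⟨T, ⟨E, hE, hT⟩, T', ⟨E', hE', hT'⟩, rfl⟩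
    exact ⟨E * E', mul_mem hE hE', hT.mul hT'⟩
  have hL : ∀ v, LinearMap.mulLeft Q v ∈ D := by
    intro v
    have hv : v ∈ Submodule.span Q (Set.range φ) := by rw [hφ]; trivial
    induction hv using Submodule.span_induction with
    | mem v hv =>
      obtain ⟨a, rfl⟩ := hv
      exact Submodule.subset_span ⟨_, mulLeft_mem_multRing a, Intertwines.mulLeft a⟩
    | zero => rw [LinearMap.mulLeft_zero_eq_zero]; exact zero_mem _
    | add v w _ _ hv hw =>
      convert add_mem hv hw using 1
      ext; simp [add_mul]
    | smul c v _ hv =>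
      convert D.smul_mem c hv using 1
      ext; simp [smul_mul_assoc]
  have hR : ∀ v, LinearMap.mulRight Q v ∈ D := by
    intro v
    have hv : v ∈ Submodule.span Q (Set.range φ) := by rw [hφ]; trivial
    induction hv using Submodule.span_induction with
    | mem v hv =>
      obtain ⟨a, rfl⟩ := hv
      exact Submodule.subset_span ⟨_, mulRight_mem_multRing a, Intertwines.mulRight a⟩
    | zero => rw [LinearMap.mulRight_zero_eq_zero]; exact zero_mem _
    | add v w _ _ hv hw =>
      convert add_mem hv hw using 1
      ext; simp [mul_add]
    | smul c v _ hv =>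
      convert D.smul_mem c hv using 1
      ext; simp [mul_smul_comm]
  have hone : (1 : Module.End Q (Q ⊗[K] A)) ∈ D :=
    Submodule.subset_span ⟨1, one_mem _, Intertwines.one⟩
  have hbase : ∀ T ∈ multAlg K A, T.baseChange Q ∈ D := by
    intro T hT
    induction hT using Algebra.adjoin_induction with
    | mem T hT =>
      rcases hT with ⟨a, rfl⟩ | ⟨a, rfl⟩
      · convert hL (1 ⊗ₜ a) using 1
        ext; simp
      · convert hR (1 ⊗ₜ a) using 1
        ext; simp
    | algebraMap k =>
      convert D.smul_mem (algebraMap K Q k) hone using 1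
      ext; simp [TensorProduct.smul_tmul']
    | add T T' _ _ h h' => rw [LinearMap.baseChange_add]; exact add_mem h h'
    | mul T T' _ _ h h' => rw [LinearMap.baseChange_mul]; exact hmul _ h _ h'
  rw [hA.multAlg_eq_top] at hbase
  rw [eq_top_iff]
  rintro T -
  let b := Module.finBasis K A
  let B := b.baseChange Q
  have hT : T = ∑ i, ∑ j, (B.repr (T (B i)) j) •
      ((b.coord i).smulRight (b j)).baseChange Q := by
    refine B.ext fun k => ?_
    simp only [LinearMap.sum_apply, LinearMap.smul_apply]
    rw [Finset.sum_eq_single k]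
    · conv_lhs => rw [← B.sum_repr (T (B k))]
      simp [B]
    · intro i _ hi
      simp [B, hi.symm]
    · simp
  rw [hT]
  exact sum_mem fun i _ => sum_mem fun j _ => D.smul_mem _ (hbase _ trivial)

theorem isDenseHom_of_span [IsAlgClosed K] [FiniteDimensional K A] (hA : IsSimpleAlg K A)
    (φ : F →ₙ+* Q ⊗[K] A) (hφ : Submodule.span Q (Set.range φ) = ⊤) : IsDenseHom Q φ := by
  refine ⟨hφ, span_ops_eq_top hA φ hφ, ?_⟩
  obtain ⟨a, b, hab⟩ := hA.1
  refine ⟨1 ⊗ₜ a, 1 ⊗ₜ b, ?_⟩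
  rw [Algebra.TensorProduct.tmul_mul_tmul, one_mul]
  have := Module.FaithfullyFlat.tensorProduct_mk_injective (A := K) (B := Q) A
  exact fun h => hab (this (by simpa using h))

end Simple

section Generic

variable {K A R S : Type*} [Field K] [NonUnitalNonAssocRing A] [Module K A] [SMulCommClass K A A]
  [IsScalarTower K A A] [CommRing R] [Algebra K R] [CommRing S] [Algebra K S]

/-- The change of scalars `R ⊗ A → S ⊗ A` along `g : R → S`. -/
noncomputable def scalarMap (A : Type*) [NonUnitalNonAssocRing A] [Module K A]
    [SMulCommClass K A A] [IsScalarTower K A A] (g : R →ₐ[K] S) : R ⊗[K] A →ₙₐ[K] S ⊗[K] A :=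
  { LinearMap.rTensor A g.toLinearMap with
    map_zero' := map_zero _
    map_mul' := fun x y => by
      change LinearMap.rTensor A g.toLinearMap (x * y) =
        LinearMap.rTensor A g.toLinearMap x * LinearMap.rTensor A g.toLinearMap y
      induction x with
      | zero => simp
      | add x x' h h' => simp [add_mul, h, h']
      | tmul r a =>
        induction y with
        | zero => simp
        | add y y' h h' => simp [mul_add, h, h']
        | tmul r' a' => simp }

@[simp]
theorem scalarMap_tmul (g : R →ₐ[K] S) (r : R) (a : A) :
    scalarMap A g (r ⊗ₜ a) = g r ⊗ₜ a := rfl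

theorem repr_scalarMap {ι : Type*} (b : Module.Basis ι K A) (g : R →ₐ[K] S) (z : R ⊗[K] A)
    (j : ι) : (b.baseChange S).repr (scalarMap A g z) j = g ((b.baseChange R).repr z j) := by
  induction z with
  | zero => simp
  | add x y h h' => simp [h, h']
  | tmul r a => simp

/-- The specialization `R ⊗ A → A` along `g : R → K`. -/
noncomputable def specialize (A : Type*) [NonUnitalNonAssocRing A] [Module K A]
    [SMulCommClass K A A] [IsScalarTower K A A] (g : R →ₐ[K] K) : R ⊗[K] A →ₙₐ[K] A :=
  { TensorProduct.lift ((LinearMap.lsmul K A).comp g.toLinearMap) with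
    map_zero' := map_zero _
    map_mul' := fun x y => by
      change TensorProduct.lift ((LinearMap.lsmul K A).comp g.toLinearMap) (x * y) =
        TensorProduct.lift ((LinearMap.lsmul K A).comp g.toLinearMap) x *
        TensorProduct.lift ((LinearMap.lsmul K A).comp g.toLinearMap) y
      induction x with
      | zero => simp
      | add x x' h h' => simp [add_mul, h, h']
      | tmul r a =>
        induction y with
        | zero => simp
        | add y y' h h' => simp [mul_add, h, h']
        | tmul r' a' => simp [smul_mul_assoc, mul_smul_comm, mul_smul, smul_comm (g r)] }

@[simp]
theorem specialize_tmul (g : R →ₐ[K] K) (r : R) (a : A) :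
    specialize A g (r ⊗ₜ a) = g r • a := rfl

theorem repr_specialize {ι : Type*} (b : Module.Basis ι K A) (g : R →ₐ[K] K) (z : R ⊗[K] A)
    (j : ι) : b.repr (specialize A g z) j = g ((b.baseChange R).repr z j) := by
  induction z with
  | zero => simp
  | add x y h h' => simp [h, h']
  | tmul r a => simp [mul_comm]

/-- The evaluation of free algebra elements at elements of `A` with generic coordinates. -/
noncomputable def genericEval {n : ℕ} (b : Module.Basis (Fin n) K A) :
    FreeNonUnitalNonAssocAlgebra K ℕ →ₙₐ[K] MvPolynomial (ℕ × Fin n) K ⊗[K] A :=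
  FreeNonUnitalNonAssocAlgebra.lift K fun k => ∑ j, MvPolynomial.X (k, j) ⊗ₜ b j

theorem specialize_genericEval {n : ℕ} (b : Module.Basis (Fin n) K A) (x : ℕ × Fin n → K)
    (f : FreeNonUnitalNonAssocAlgebra K ℕ) :
    specialize A (MvPolynomial.aeval x) (genericEval b f) =
      FreeNonUnitalNonAssocAlgebra.lift K (fun k => ∑ j, x (k, j) • b j) f := by
  have : (specialize A (MvPolynomial.aeval x)).comp (genericEval b) =
      FreeNonUnitalNonAssocAlgebra.lift K (fun k => ∑ j, x (k, j) • b j) := by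
    refine FreeNonUnitalNonAssocAlgebra.hom_ext K fun k => ?_
    simp [genericEval]
  exact congrArg (fun h => h f) this

theorem genericEval_eq_zero_iff [Infinite K] {n : ℕ} (b : Module.Basis (Fin n) K A)
    (f : FreeNonUnitalNonAssocAlgebra K ℕ) : genericEval b f = 0 ↔ IsPI (A := A) f := by
  refine ⟨fun h v => ?_, fun h => ?_⟩
  · have := specialize_genericEval b (fun p => b.repr (v p.1) p.2) f
    rw [h, map_zero] at this
    simpa [b.sum_repr] using this.symm
  · refine (b.baseChange _).ext_elem fun j => MvPolynomial.funext fun x => ?_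
    have := repr_specialize b (MvPolynomial.aeval x) (genericEval b f) j
    rw [specialize_genericEval, h, map_zero] at this
    rw [map_zero, Finsupp.zero_apply, map_zero, ← MvPolynomial.coe_aeval_eq_eval]
    exact this.symm

theorem span_range_genericEval {n : ℕ} (b : Module.Basis (Fin n) K A) {Q : Type*} [Field Q]
    [Algebra K Q] (g : MvPolynomial (ℕ × Fin n) K →ₐ[K] Q) (hg : Function.Injective g) :
    Submodule.span Q (Set.range ((scalarMap A g).comp (genericEval b))) = ⊤ := by
  let M₀ : Matrix (Fin n) (Fin n) (MvPolynomial (ℕ × Fin n) K) :=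
    Matrix.of fun k j => MvPolynomial.X ((k : ℕ), j)
  let M := g.toRingHom.mapMatrix M₀
  have hM₀ : M₀.det ≠ 0 := by
    intro h
    let x : ℕ × Fin n → K := fun p => if p.1 = p.2 then 1 else 0
    have h1 := RingHom.map_det (MvPolynomial.eval x) M₀
    have h2 : (MvPolynomial.eval x).mapMatrix M₀ = 1 := by
      ext k j
      simp [M₀, x, Matrix.one_apply, Fin.ext_iff]
    rw [h, h2, map_zero, Matrix.det_one] at h1
    exact zero_ne_one h1
  have hM : IsUnit M.det := by
    rw [← RingHom.map_det, isUnit_iff_ne_zero]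
    exact (map_ne_zero_iff _ hg).2 hM₀
  rw [eq_top_iff, ← (b.baseChange Q).span_eq, Submodule.span_le]
  rintro _ ⟨j, rfl⟩
  have hj : (b.baseChange Q) j = ∑ k, M⁻¹ j k • ((scalarMap A g).comp (genericEval b))
      (FreeNonUnitalNonAssocAlgebra.of K (k : ℕ)) := by
    have h1 : ∀ k : Fin n, ((scalarMap A g).comp (genericEval b))
        (FreeNonUnitalNonAssocAlgebra.of K (k : ℕ)) = ∑ l, M k l • (b.baseChange Q) l := by
      intro k
      simp [genericEval, M, M₀, TensorProduct.smul_tmul']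
    simp only [h1, Finset.smul_sum, smul_smul]
    rw [Finset.sum_comm]
    simp only [← Finset.sum_smul, ← Matrix.mul_apply, Matrix.nonsing_inv_mul M hM]
    simp [Matrix.one_apply]
  rw [hj]
  exact sum_mem fun k _ => Submodule.smul_mem _ _ (Submodule.subset_span ⟨_, rfl⟩)

/-- The free algebra maps densely to a scalar extension of a simple algebra, and the kernel of
this map is the set of polynomial identities. -/
theorem exists_generic {K : Type u} {A : Type v} [Field K] [IsAlgClosed K]
    [NonUnitalNonAssocRing A] [Module K A] [SMulCommClass K A A] [IsScalarTower K A A]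
    [FiniteDimensional K A] (hA : IsSimpleAlg K A) :
    ∃ (Q : Type u) (_ : Field Q) (_ : Algebra K Q)
      (φ : FreeNonUnitalNonAssocAlgebra K ℕ →ₙ+* Q ⊗[K] A),
      IsDenseHom Q φ ∧ (∀ (k : K) f, φ (k • f) = algebraMap K Q k • φ f) ∧
        ∀ f, φ f = 0 ↔ IsPI (A := A) f := by
  have : Infinite K := IsAlgClosed.instInfinite
  let b := Module.finBasis K A
  let R := MvPolynomial (ℕ × Fin (Module.finrank K A)) K
  let g : R →ₐ[K] FractionRing R := IsScalarTower.toAlgHom K R (FractionRing R)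
  have hg : Function.Injective g := IsFractionRing.injective R (FractionRing R)
  let φ := (scalarMap A g).comp (genericEval b)
  refine ⟨FractionRing R, inferInstance, inferInstance, φ,
    isDenseHom_of_span hA _ (span_range_genericEval b g hg), fun k f => ?_, fun f => ?_⟩
  · rw [algebraMap_smul]
    exact map_smul φ k f
  rw [← genericEval_eq_zero_iff b]
  refine ⟨fun h => (b.baseChange R).ext_elem fun j => hg ?_, fun h => ?_⟩
  · rw [← repr_scalarMap]
    have h' : scalarMap A g (genericEval b f) = 0 := h
    simp [h']
  · change scalarMap A g (genericEval b f) = 0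
    rw [h, map_zero]

end Generic

section StructureConstants

variable {ι : Type*} [Fintype ι] {R : Type*} [CommRing R]

/-- The rows of `G` multiply, under the structure constants `s`, with structure constants `c`. -/
def IsMulMatrix (c s : ι → ι → ι → R) (G : Matrix ι ι R) : Prop :=
  ∀ i j e, ∑ k, c i j k * G k e = ∑ a, ∑ a', G i a * G j a' * s a a' e

theorem IsMulMatrix.map {S : Type*} [CommRing S] {c s : ι → ι → ι → R} {G : Matrix ι ι R}
    (h : IsMulMatrix c s G) (f : R →+* S) :
    IsMulMatrix (fun i j k => f (c i j k)) (fun i j k => f (s i j k)) (G.map f) := by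
  intro i j e
  simpa using congrArg f (h i j e)

theorem IsMulMatrix.of_map {S : Type*} [CommRing S] {c s : ι → ι → ι → R} {G : Matrix ι ι R}
    {f : R →+* S} (hf : Function.Injective f)
    (h : IsMulMatrix (fun i j k => f (c i j k)) (fun i j k => f (s i j k)) (G.map f)) :
    IsMulMatrix c s G := by
  intro i j e
  apply hf
  simpa using h i j e

theorem IsMulMatrix.mul {c d e : ι → ι → ι → R} {G H : Matrix ι ι R} (hG : IsMulMatrix c d G)
    (hH : IsMulMatrix d e H) : IsMulMatrix c e (G * H) := by
  intro i j l
  calc ∑ k, c i j k * (G * H) k l = ∑ m, (∑ k, c i j k * G k m) * H m l := by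
        simp only [Matrix.mul_apply, Finset.mul_sum, Finset.sum_mul, mul_assoc]
        exact Finset.sum_comm
    _ = ∑ a, ∑ a', G i a * G j a' * ∑ m, d a a' m * H m l := by
        simp only [hG i j, Finset.sum_mul, Finset.mul_sum, mul_assoc]
        rw [Finset.sum_comm]
        exact Finset.sum_congr rfl fun a _ => Finset.sum_comm
    _ = ∑ a, ∑ a', ∑ p, ∑ q, (G i a * H a p) * (G j a' * H a' q) * e p q l := by
        simp only [hH _ _, Finset.mul_sum]
        refine Finset.sum_congr rfl fun a _ => Finset.sum_congr rfl fun a' _ =>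
          Finset.sum_congr rfl fun p _ => Finset.sum_congr rfl fun q _ => ?_
        ring
    _ = ∑ p, ∑ q, (G * H) i p * (G * H) j q * e p q l := by
        simp_rw [Matrix.mul_apply, Finset.sum_mul_sum, Finset.sum_mul]
        calc _ = ∑ a, ∑ p, ∑ a', ∑ q, (G i a * H a p) * (G j a' * H a' q) * e p q l :=
              Finset.sum_congr rfl fun a _ => Finset.sum_comm
          _ = ∑ p, ∑ a, ∑ a', ∑ q, (G i a * H a p) * (G j a' * H a' q) * e p q l :=
              Finset.sum_comm
          _ = ∑ p, ∑ a, ∑ q, ∑ a', (G i a * H a p) * (G j a' * H a' q) * e p q l :=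
              Finset.sum_congr rfl fun p _ => Finset.sum_congr rfl fun a _ => Finset.sum_comm
          _ = _ := Finset.sum_congr rfl fun p _ => Finset.sum_comm

theorem isMulMatrix_of_bases {V : Type*} [NonUnitalNonAssocRing V] [Module R V]
    [SMulCommClass R V V] [IsScalarTower R V V] (β B : Module.Basis ι R V) :
    IsMulMatrix (fun i j k => β.repr (β i * β j) k) (fun i j k => B.repr (B i * B j) k)
      (Matrix.of fun i a => B.repr (β i) a) := by
  intro i j e
  have h1 : B.repr (β i * β j) e = ∑ k, β.repr (β i * β j) k * B.repr (β k) e := by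
    conv_lhs => rw [← β.sum_repr (β i * β j)]
    simp [-Module.Basis.sum_repr]
  have h2 : B.repr (β i * β j) e =
      ∑ a, ∑ a', B.repr (β i) a * B.repr (β j) a' * B.repr (B a * B a') e := by
    conv_lhs => rw [← B.sum_repr (β i), ← B.sum_repr (β j)]
    simp [-Module.Basis.sum_repr, Finset.sum_mul, Finset.mul_sum, smul_mul_assoc, mul_smul_comm, mul_assoc,
      mul_left_comm]
    exact Finset.sum_comm
  exact h1.symm.trans h2

theorem reprMatrix_mul_reprMatrix {V : Type*} [AddCommGroup V] [Module R V] [DecidableEq ι]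
    (β B : Module.Basis ι R V) :
    (Matrix.of fun i a => B.repr (β i) a) * (Matrix.of fun i a => β.repr (B i) a) = 1 := by
  ext i j
  have := congrArg (fun v => β.repr v j) (B.sum_repr (β i))
  simpa [-Module.Basis.sum_repr, Matrix.mul_apply, Matrix.one_apply, Finsupp.single_apply]
    using this

theorem map_mul_map_eq_one [DecidableEq ι] {S : Type*} [CommRing S] (g : R →+* S)
    {M N : Matrix ι ι R} (h : M * N = 1) : M.map g * N.map g = 1 := by
  rw [← Matrix.map_mul, h, Matrix.map_one _ (map_zero _) (map_one _)]

/-- A nonzero algebra of finite type over an algebraically closed field has a rational point. -/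
theorem exists_algHom_of_finiteType (K D : Type*) [Field K] [IsAlgClosed K] [CommRing D]
    [Algebra K D] [Nontrivial D] [Algebra.FiniteType K D] : Nonempty (D →ₐ[K] K) := by
  obtain ⟨m, hm⟩ := Ideal.exists_maximal D
  let _ := Ideal.Quotient.field m
  have : Module.Finite K (D ⧸ m) := finite_of_finite_type_of_isJacobsonRing K (D ⧸ m)
  exact ⟨(IsAlgClosed.lift : (D ⧸ m) →ₐ[K] K).comp (Ideal.Quotient.mkₐ K m)⟩

/-- An invertible solution of the multiplicativity equations over a nonzero `K`-algebra yields
one over `K`. -/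
theorem exists_isMulMatrix_of_extension {K Ω : Type*} [Field K] [IsAlgClosed K] [CommRing Ω]
    [Algebra K Ω] [Nontrivial Ω] [DecidableEq ι] {s s' : ι → ι → ι → K} {P P' : Matrix ι ι Ω}
    (h : IsMulMatrix (fun i j k => algebraMap K Ω (s i j k))
      (fun i j k => algebraMap K Ω (s' i j k)) P) (hP : P * P' = 1) (hP' : P' * P = 1) :
    ∃ G G' : Matrix ι ι K, IsMulMatrix s s' G ∧ G * G' = 1 ∧ G' * G = 1 := by
  let X : Set Ω := Set.range (fun p : ι × ι => P p.1 p.2) ∪ Set.range fun p : ι × ι => P' p.1 p.2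
  let D := Algebra.adjoin K X
  have : Algebra.FiniteType K D :=
    (Subalgebra.fg_iff_finiteType _).1 ⟨(Set.toFinite X).toFinset, by simp [D]⟩
  obtain ⟨f⟩ := exists_algHom_of_finiteType K D
  let N : Matrix ι ι D :=
    Matrix.of fun i j => ⟨P i j, Algebra.subset_adjoin (Or.inl ⟨(i, j), rfl⟩)⟩
  let N' : Matrix ι ι D :=
    Matrix.of fun i j => ⟨P' i j, Algebra.subset_adjoin (Or.inr ⟨(i, j), rfl⟩)⟩
  have hinj : Function.Injective D.val.toRingHom := Subtype.val_injective
  have hN : N.map D.val.toRingHom = P := rfl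
  have hN' : N'.map D.val.toRingHom = P' := rfl
  have h1 : N * N' = 1 := Matrix.map_injective hinj (by
    beta_reduce
    rw [Matrix.map_mul, hN, hN', hP, Matrix.map_one _ (map_zero _) (map_one _)])
  have h2 : N' * N = 1 := Matrix.map_injective hinj (by
    beta_reduce
    rw [Matrix.map_mul, hN, hN', hP', Matrix.map_one _ (map_zero _) (map_one _)])
  have h3 : IsMulMatrix (fun i j k => algebraMap K D (s i j k))
      (fun i j k => algebraMap K D (s' i j k)) N := IsMulMatrix.of_map hinj h
  refine ⟨N.map f.toRingHom, N'.map f.toRingHom, ?_, ?_, ?_⟩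
  · simpa using h3.map f.toRingHom
  · rw [← Matrix.map_mul, h1, Matrix.map_one _ (map_zero _) (map_one _)]
  · rw [← Matrix.map_mul, h2, Matrix.map_one _ (map_zero _) (map_one _)]

theorem constr_comp_constr {K A B : Type*} [CommRing K] [DecidableEq ι] [AddCommGroup A]
    [Module K A] [AddCommGroup B] [Module K B] (b : Module.Basis ι K A) (b' : Module.Basis ι K B)
    {G G' : Matrix ι ι K} (hG : G * G' = 1) :
    (b'.constr K fun i => ∑ j, G' i j • b j) ∘ₗ (b.constr K fun i => ∑ j, G i j • b' j) =
      LinearMap.id := by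
  refine b.ext fun i => ?_
  simp only [LinearMap.comp_apply, Module.Basis.constr_basis, map_sum, map_smul,
    Finset.smul_sum, smul_smul, LinearMap.id_apply]
  rw [Finset.sum_comm]
  simp only [← Finset.sum_smul, ← Matrix.mul_apply, hG]
  simp [Matrix.one_apply]

theorem exists_mulEquiv_of_isMulMatrix {K A B : Type*} [Field K] [DecidableEq ι]
    [NonUnitalNonAssocRing A] [Module K A] [SMulCommClass K A A] [IsScalarTower K A A]
    [NonUnitalNonAssocRing B] [Module K B] [SMulCommClass K B B] [IsScalarTower K B B]
    (b : Module.Basis ι K A) (b' : Module.Basis ι K B) {G G' : Matrix ι ι K}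
    (h : IsMulMatrix (fun i j k => b.repr (b i * b j) k) (fun i j k => b'.repr (b' i * b' j) k) G)
    (hG : G * G' = 1) (hG' : G' * G = 1) :
    ∃ φ : A ≃ₗ[K] B, ∀ a b : A, φ (a * b) = φ a * φ b := by
  let φ : A ≃ₗ[K] B := LinearEquiv.ofLinearMap (b.constr K fun i => ∑ j, G i j • b' j)
    (b'.constr K fun i => ∑ j, G' i j • b j) (constr_comp_constr b' b hG') (constr_comp_constr b b' hG)
  have hφ : ∀ i, φ (b i) = ∑ j, G i j • b' j := fun i => b.constr_basis K _ i
  refine ⟨φ, fun x y => ?_⟩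
  have : (LinearMap.mul K A).compr₂ φ.toLinearMap =
      (LinearMap.mul K B).compl₁₂ φ.toLinearMap φ.toLinearMap := by
    refine LinearMap.ext_basis b b fun i j => ?_
    change φ (b i * b j) = φ (b i) * φ (b j)
    refine b'.ext_elem fun e => ?_
    have h1 : b'.repr (φ (b i * b j)) e = ∑ k, b.repr (b i * b j) k * G k e := by
      conv_lhs => rw [← b.sum_repr (b i * b j)]
      simp [-Module.Basis.sum_repr, hφ, Finsupp.single_apply]
    have h2 : b'.repr (φ (b i) * φ (b j)) e =
        ∑ a, ∑ a', G i a * G j a' * b'.repr (b' a * b' a') e := by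
      simp [hφ, Finset.sum_mul, Finset.mul_sum, smul_mul_assoc, mul_smul_comm, mul_assoc,
        mul_left_comm]
      exact Finset.sum_comm
    rw [h1, h2]
    exact h i j e
  exact congrArg (fun m => m x y) this

end StructureConstants

section Descent

variable {K A B Q Q' Ω ι : Type*} [Field K]
  [NonUnitalNonAssocRing A] [Module K A] [SMulCommClass K A A] [IsScalarTower K A A]
  [NonUnitalNonAssocRing B] [Module K B] [SMulCommClass K B B] [IsScalarTower K B B]
  [Field Q] [Algebra K Q] [Field Q'] [Algebra K Q'] [CommRing Ω] [Algebra K Ω] [Nontrivial Ω]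

theorem repr_baseChange_mul (b : Module.Basis ι K A) (i j k : ι) :
    (b.baseChange Q).repr (b.baseChange Q i * b.baseChange Q j) k =
      algebraMap K Q (b.repr (b i * b j) k) := by
  simp [Algebra.algebraMap_eq_smul_one]

/-- Two algebras over an algebraically closed field are isomorphic if scalar extensions of them
have bases whose structure constants agree in a common nonzero extension. -/
theorem exists_mulEquiv_of_common_structure_constants [IsAlgClosed K] [Fintype ι]
    (b : Module.Basis ι K A) (b' : Module.Basis ι K B) (β : Module.Basis ι Q (Q ⊗[K] A))
    (β' : Module.Basis ι Q' (Q' ⊗[K] B)) (f : Q →ₐ[K] Ω) (f' : Q' →ₐ[K] Ω)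
    (h : ∀ i j k, f (β.repr (β i * β j) k) = f' (β'.repr (β' i * β' j) k)) :
    ∃ φ : A ≃ₗ[K] B, ∀ a b : A, φ (a * b) = φ a * φ b := by
  classical
  let C := b.baseChange Q
  let C' := b'.baseChange Q'
  let G : Matrix ι ι Q := Matrix.of fun i a => β.repr (C i) a
  let G₁ : Matrix ι ι Q := Matrix.of fun i a => C.repr (β i) a
  let H : Matrix ι ι Q' := Matrix.of fun i a => C'.repr (β' i) a
  let H₁ : Matrix ι ι Q' := Matrix.of fun i a => β'.repr (C' i) a
  have hG := (isMulMatrix_of_bases C β).map f.toRingHom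
  have hH := (isMulMatrix_of_bases β' C').map f'.toRingHom
  have hs : (fun i j k => f.toRingHom (C.repr (C i * C j) k)) =
      fun i j k => algebraMap K Ω (b.repr (b i * b j) k) := by
    funext i j k
    rw [repr_baseChange_mul]
    exact f.commutes _
  have hs' : (fun i j k => f'.toRingHom (C'.repr (C' i * C' j) k)) =
      fun i j k => algebraMap K Ω (b'.repr (b' i * b' j) k) := by
    funext i j k
    rw [repr_baseChange_mul]
    exact f'.commutes _
  have hc : (fun i j k => f.toRingHom (β.repr (β i * β j) k)) =
      fun i j k => f'.toRingHom (β'.repr (β' i * β' j) k) := by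
    funext i j k
    exact h i j k
  rw [hs, hc] at hG
  rw [hs'] at hH
  have e1 : G.map f.toRingHom * G₁.map f.toRingHom = 1 :=
    map_mul_map_eq_one _ (reprMatrix_mul_reprMatrix C β)
  have e2 : G₁.map f.toRingHom * G.map f.toRingHom = 1 :=
    map_mul_map_eq_one _ (reprMatrix_mul_reprMatrix β C)
  have e3 : H.map f'.toRingHom * H₁.map f'.toRingHom = 1 :=
    map_mul_map_eq_one _ (reprMatrix_mul_reprMatrix β' C')
  have e4 : H₁.map f'.toRingHom * H.map f'.toRingHom = 1 :=
    map_mul_map_eq_one _ (reprMatrix_mul_reprMatrix C' β')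
  obtain ⟨N, N', hN, h1, h2⟩ := exists_isMulMatrix_of_extension (hG.mul hH)
    (P' := H₁.map f'.toRingHom * G₁.map f.toRingHom)
    (by rw [Matrix.mul_assoc, ← Matrix.mul_assoc _ _ (G₁.map _), e3, Matrix.one_mul, e1])
    (by rw [Matrix.mul_assoc, ← Matrix.mul_assoc _ _ (H.map _), e2, Matrix.one_mul, e4])
  exact exists_mulEquiv_of_isMulMatrix b b' hN h1 h2

end Descent

theorem IsDenseHom.exists_basis {F V Q : Type*} [NonUnitalNonAssocRing F]
    [NonUnitalNonAssocRing V] [Field Q] [Module Q V] [FiniteDimensional Q V] {φ : F →ₙ+* V}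
    (hφ : IsDenseHom Q φ) :
    ∃ (u : Fin (Module.finrank Q V) → F) (β : Module.Basis (Fin (Module.finrank Q V)) Q V),
      ∀ i, β i = φ (u i) := by
  obtain ⟨s, hs, hspan, hli⟩ := exists_linearIndependent Q (Set.range φ)
  rw [hφ.span_range] at hspan
  let β := Module.Basis.mk hli (by simp [hspan])
  have : Fintype s := FiniteDimensional.fintypeBasisIndex β
  let e := Fintype.equivFinOfCardEq (Module.finrank_eq_card_basis β).symm
  choose u hu using fun x : s => hs x.2
  exact ⟨fun i => u (e.symm i), β.reindex e, fun i => by simp [β, hu]⟩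

theorem finrank_le_of_dense {F V Q V' Q' : Type*} [NonUnitalNonAssocRing F]
    [NonUnitalNonAssocRing V] [Field Q] [Module Q V] [SMulCommClass Q V V] [IsScalarTower Q V V]
    [FiniteDimensional Q V] [NonUnitalNonAssocRing V'] [Field Q'] [Module Q' V']
    [SMulCommClass Q' V' V'] [IsScalarTower Q' V' V'] [FiniteDimensional Q' V']
    {φ : F →ₙ+* V} {ψ : F →ₙ+* V'} (hφ : IsDenseHom Q φ) (hker : ∀ f, φ f = 0 ↔ ψ f = 0) :
    Module.finrank Q V ≤ Module.finrank Q' V' := by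
  obtain ⟨u, β, hβ⟩ := hφ.exists_basis
  have hu : LinearIndependent Q (fun i => φ (u i)) := by
    simpa only [← hβ] using β.linearIndependent
  simpa using (hφ.linearIndependent_transfer (Q' := Q') hker hu).fintype_card_le_finrank

theorem simple_same_identities_isomorphic
    (K A B : Type*) [Field K] [IsAlgClosed K]
    [NonUnitalNonAssocRing A] [Module K A] [SMulCommClass K A A] [IsScalarTower K A A]
    [FiniteDimensional K A]
    [NonUnitalNonAssocRing B] [Module K B] [SMulCommClass K B B] [IsScalarTower K B B]
    [FiniteDimensional K B]
    (hA : IsSimpleAlg K A) (hB : IsSimpleAlg K B)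
    (hsame : ∀ f : FreeNonUnitalNonAssocAlgebra K ℕ, IsPI (A := A) f ↔ IsPI (A := B) f) :
    ∃ φ : A ≃ₗ[K] B, ∀ a b : A, φ (a * b) = φ a * φ b := by
  obtain ⟨Q, _, _, φ, hφ, hφK, hφker⟩ := exists_generic hA
  obtain ⟨Q', _, _, ψ, hψ, hψK, hψker⟩ := exists_generic hB
  have hker : ∀ f, φ f = 0 ↔ ψ f = 0 := fun f => by rw [hφker, hψker, hsame]
  have hrank : Module.finrank Q (Q ⊗[K] A) = Module.finrank Q' (Q' ⊗[K] B) :=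
    (finrank_le_of_dense hφ hker).antisymm (finrank_le_of_dense hψ fun f => (hker f).symm)
  obtain ⟨u, β, hβ⟩ := hφ.exists_basis
  have hu : LinearIndependent Q (fun i => φ (u i)) := by
    have := β.linearIndependent
    rwa [funext hβ] at this
  have hu' := hφ.linearIndependent_transfer (Q' := Q') hker hu
  have : Nonempty (Fin (Module.finrank Q (Q ⊗[K] A))) := by
    obtain ⟨x, y, hxy⟩ := hφ.exists_mul_ne_zero
    have : Nontrivial (Q ⊗[K] A) := ⟨x * y, 0, hxy⟩
    exact β.index_nonempty
  let β' := basisOfLinearIndependentOfCardEqFinrank hu' (by simp [hrank])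
  have hβ' : ∀ i, β' i = ψ (u i) := fun i => by simp [β']
  obtain ⟨Ω, _, _, _, f, f', hff'⟩ := exists_common_extension (commonScalars hφ hφK hψK)
    fun c hc => fst_eq_zero_iff_of_mem_commonScalars hφ hker hφK hψK hc
  let b := Module.finBasisOfFinrankEq K A
    (Module.finrank_baseChange (R := Q) (M' := A)).symm
  let b' := Module.finBasisOfFinrankEq K B
    ((Module.finrank_baseChange (R := Q') (M' := B)).symm.trans hrank.symm)
  refine exists_mulEquiv_of_common_structure_constants b b' β β' f f' fun i j k => ?_
  have := hff' _ (repr_mem_commonScalars hφ hker hφK hψK β hβ β' hβ' (u i * u j) k)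
  simpa [hβ, hβ'] using this
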